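/- There is no asymptotically correct discrimination procedure for the class of all stationary ergodic binary processes. That is, for every family D = (D_n) of measurable maps D_n : ({0,1}^n) × ({0,1}^n) → {0,1}, it is not the case that for every pair of stationary ergodic binary processes ρ_x, ρ_y, when x and y are generated independently with distributions ρ_x and ρ_y, the expectation E[D_n((x_1,…,x_n),(y_1,…,y_n))] converges as n → ∞ to 0 if ρ_x = ρ_y and to 1 if ρ_x ≠ ρ_y. -/

import Mathlib

open scoped Classical

open MeasureTheory

/-- Binary sequences: the sample space of a binary process. -/
abbrev BinSeq : Type := ℕ → Bool

/-- The shift map on one-way infinite sequences. -/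
def shift {α : Type*} : (ℕ → α) → (ℕ → α) := fun x n => x (n + 1)

/-- Expected output of the discrimination procedure `D` at time `n`, when the two
sample sequences are generated independently with distributions `ρx` and `ρy`:
`D n` is applied to the first `n` coordinates of each sequence, and the expectation
is taken with respect to the product measure `ρx × ρy`. -/
noncomputable def expD (D : ∀ n : ℕ, (Fin n → Bool) → (Fin n → Bool) → Bool)
    (ρx ρy : Measure BinSeq) (n : ℕ) : ℝ :=
  ∫ z : BinSeq × BinSeq,
    (if D n (fun i => z.1 ↑i) (fun i => z.2 ↑i) then (1 : ℝ) else 0) ∂(ρx.prod ρy)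

/-- The binary sequence recording the visits of the orbit of `x` under the `2`-adic odometer
`x ↦ x + 1` to the set `A`. -/
noncomputable def odometerItinerary (A : Set ℤ_[2]) (x : ℤ_[2]) : BinSeq :=
  fun n => decide (x + n ∈ A)

/-- The pairs of starting points whose itineraries through `A` and `B` are declared different by
`D` at time `n`. -/
def rejectionSet (D : ∀ n : ℕ, (Fin n → Bool) → (Fin n → Bool) → Bool) (n : ℕ)
    (A B : Set ℤ_[2]) : Set (ℤ_[2] × ℤ_[2]) :=
  {z | D n (fun i => odometerItinerary A z.1 i) (fun i => odometerItinerary B z.2 i) = true}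

theorem measurable_shift : Measurable (shift : BinSeq → BinSeq) :=
  measurable_pi_lambda _ fun n => measurable_pi_apply (n + 1)

/-- If a measure preserving map exchanges the two pieces of a set, these have equal measure. -/
theorem measureReal_eq_two_mul_of_preimage_inter {X : Type*} [MeasurableSpace X] {ν : Measure X}
    [IsFiniteMeasure ν] {τ : X → X} (hτ : MeasurePreserving τ ν ν) {S C : Set X}
    (hS : MeasurableSet S) (hC : MeasurableSet C) (h : τ ⁻¹' (S ∩ C) = S \ C) :
    ν.real S = 2 * ν.real (S ∩ C) := by
  have h1 := hτ.measureReal_preimage (hS.inter hC).nullMeasurableSet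
  rw [h] at h1
  have h2 := measureReal_inter_add_sdiff (μ := ν) (s := S) hC
  linarith

theorem measureReal_prod_le_add_of_subset {X : Type*} [MeasurableSpace X] {μ : Measure X}
    [IsProbabilityMeasure μ] {S T : Set (X × X)} {E : Set X}
    (h : ∀ z ∈ S, z.1 ∉ E → z.2 ∉ E → z ∈ T) :
    (μ.prod μ).real S ≤ (μ.prod μ).real T + 2 * μ.real E := by
  have hsub : S ⊆ T ∪ (E ×ˢ Set.univ ∪ Set.univ ×ˢ E) := by
    intro z hz
    by_cases h1 : z.1 ∈ E
    · simp [h1]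
    by_cases h2 : z.2 ∈ E
    · simp [h2]
    exact Or.inl (h z hz h1 h2)
  have h1 := measureReal_mono (μ := μ.prod μ) hsub
  have h2 := measureReal_union_le (μ := μ.prod μ) T (E ×ˢ Set.univ ∪ Set.univ ×ˢ E)
  have h3 := measureReal_union_le (μ := μ.prod μ) (E ×ˢ Set.univ) (Set.univ ×ˢ E)
  rw [measureReal_prod_prod, measureReal_prod_prod] at h3
  simp only [probReal_univ] at h3
  linarith

theorem setOf_two_pow_dvd_eq_closedBall (k : ℕ) :
    {x : ℤ_[2] | (2 : ℤ_[2]) ^ k ∣ x} = Metric.closedBall 0 ((2 : ℝ) ^ (-(k : ℤ))) := by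
  ext x
  have := PadicInt.norm_le_pow_iff_mem_span_pow (p := 2) x k
  rw [Ideal.mem_span_singleton] at this
  simpa using this.symm

theorem PadicInt.not_two_dvd_iff_two_dvd_add_one (x : ℤ_[2]) : ¬ 2 ∣ x ↔ (2 : ℤ_[2]) ∣ x + 1 := by
  have key (y : ℤ_[2]) : (2 : ℤ_[2]) ∣ y ↔ PadicInt.toZModPow 1 y = 0 := by
    rw [← RingHom.mem_ker, PadicInt.ker_toZModPow, Ideal.mem_span_singleton]
    simp
  rw [key, key, map_add, map_one]
  generalize PadicInt.toZModPow 1 x = a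
  change ZMod 2 at a
  revert a
  decide

/-- The `2`-adic integers whose `K`-th binary digit is `0`. -/
def zeroDigitSet (K : ℕ) : Set ℤ_[2] :=
  {x | ∃ j < 2 ^ K, (2 : ℤ_[2]) ^ (K + 1) ∣ x - (j : ℕ)}

theorem mem_zeroDigitSet_iff (K : ℕ) (x : ℤ_[2]) :
    x ∈ zeroDigitSet K ↔ (PadicInt.toZModPow (K + 1) x).val < 2 ^ K := by
  have key (y : ℤ_[2]) : (2 : ℤ_[2]) ^ (K + 1) ∣ y ↔ PadicInt.toZModPow (K + 1) y = 0 := by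
    rw [← RingHom.mem_ker, PadicInt.ker_toZModPow, Ideal.mem_span_singleton]
    simp
  simp only [zeroDigitSet, Set.mem_ofPred_eq, key, map_sub, map_natCast, sub_eq_zero]
  have hK : 2 ^ K < 2 ^ (K + 1) := Nat.pow_lt_pow_succ (by norm_num)
  constructor
  · rintro ⟨j, hj, h⟩
    rw [h, ZMod.val_natCast_of_lt (hj.trans hK)]
    exact hj
  · intro h
    exact ⟨_, h, by simp⟩

theorem add_two_pow_mem_zeroDigitSet_iff (K : ℕ) (x : ℤ_[2]) :
    x + 2 ^ K ∈ zeroDigitSet K ↔ x ∉ zeroDigitSet K := by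
  have hK : 2 ^ (K + 1) = 2 * 2 ^ K := by ring
  have hpos : 0 < 2 ^ K := by positivity
  rw [mem_zeroDigitSet_iff, mem_zeroDigitSet_iff, map_add]
  have h2 : PadicInt.toZModPow (p := 2) (K + 1) (2 ^ K) = ((2 ^ K : ℕ) : ZMod (2 ^ (K + 1))) := by
    rw [← map_natCast (PadicInt.toZModPow (p := 2) (K + 1))]
    simp
  rw [h2, ZMod.val_add, ZMod.val_natCast_of_lt (by omega)]
  have := ZMod.val_lt (PadicInt.toZModPow (p := 2) (K + 1) x)
  generalize (PadicInt.toZModPow (p := 2) (K + 1) x).val = v at *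
  rcases lt_or_ge v (2 ^ K) with h | h
  · rw [Nat.mod_eq_of_lt (by omega)]
    omega
  · rw [Nat.mod_eq_sub_mod (by omega), Nat.mod_eq_of_lt (by omega)]
    omega

theorem add_one_mem_zeroDigitSet_iff (K : ℕ) (x : ℤ_[2]) (h : ¬ (2 : ℤ_[2]) ^ K ∣ x + 1) :
    x + 1 ∈ zeroDigitSet K ↔ x ∈ zeroDigitSet K := by
  have hK : 2 ^ (K + 1) = 2 * 2 ^ K := by ring
  have hpos : 0 < 2 ^ K := by positivity
  rw [mem_zeroDigitSet_iff, mem_zeroDigitSet_iff, map_add, map_one]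
  set a := PadicInt.toZModPow (p := 2) (K + 1) x with ha
  have hx : a = (a.val : ZMod (2 ^ (K + 1))) := by simp
  have hdvd : (2 : ℤ_[2]) ^ (K + 1) ∣ x - (a.val : ℕ) := by
    have : x - (a.val : ℕ) ∈ RingHom.ker (PadicInt.toZModPow (p := 2) (K + 1)) := by
      rw [RingHom.mem_ker, map_sub, map_natCast, ← hx, sub_self]
    rw [PadicInt.ker_toZModPow, Ideal.mem_span_singleton] at this
    simpa using this
  have hne : ¬ 2 ^ K ∣ a.val + 1 := by
    intro hd
    apply h
    have h1 : (2 : ℤ_[2]) ^ K ∣ ((a.val + 1 : ℕ) : ℤ_[2]) := by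
      have := Nat.cast_dvd_cast (α := ℤ_[2]) hd
      simpa using this
    have h2 := dvd_add ((pow_dvd_pow 2 K.le_succ).trans hdvd) h1
    convert h2 using 1
    push_cast
    ring
  have hlt := ZMod.val_lt a
  have n1 : a.val + 1 ≠ 2 ^ K := fun h => hne h.symm.dvd
  have n2 : a.val + 1 ≠ 2 ^ (K + 1) := fun h => hne ((pow_dvd_pow 2 K.le_succ).trans h.symm.dvd)
  have h1 : (a + 1).val = a.val + 1 := by
    have : a + 1 = ((a.val + 1 : ℕ) : ZMod (2 ^ (K + 1))) := by
      push_cast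
      rw [← hx]
    rw [this, ZMod.val_natCast_of_lt (by omega)]
  rw [h1]
  omega

/-- The pairs of sequences declared different by `D` at time `n` form a measurable set. -/
theorem measurableSet_setOf_discrimination
    (D : ∀ n : ℕ, (Fin n → Bool) → (Fin n → Bool) → Bool) (n : ℕ) :
    MeasurableSet {z : BinSeq × BinSeq |
      D n (fun i => z.1 ↑i) (fun i => z.2 ↑i) = true} := by
  have h : Measurable fun z : BinSeq × BinSeq =>
      ((fun i => z.1 ↑i, fun i => z.2 ↑i) : (Fin n → Bool) × (Fin n → Bool)) := by
    fun_prop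
  exact h (Set.toFinite {w | D n w.1 w.2 = true}).measurableSet

theorem odometerItinerary_congr {A B : Set ℤ_[2]} {x y : ℤ_[2]} {n : ℕ}
    (h : ∀ i < n, x + (i : ℤ_[2]) ∈ A ↔ y + (i : ℤ_[2]) ∈ B) :
    (fun i : Fin n => odometerItinerary A x i) = fun i : Fin n => odometerItinerary B y i := by
  funext i
  simp [odometerItinerary, h i i.2]

/-- A set of `2`-adic integers invariant under translation by `2 ^ k`. -/
def IsTwoPowInvariant (k : ℕ) (A : Set ℤ_[2]) : Prop :=
  ∀ x, x + 2 ^ k ∈ A ↔ x ∈ A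

theorem IsTwoPowInvariant.mono {k l : ℕ} {A : Set ℤ_[2]} (h : IsTwoPowInvariant k A)
    (hkl : k ≤ l) : IsTwoPowInvariant l A := by
  induction l, hkl using Nat.le_induction with
  | base => exact h
  | succ l _ ih =>
    intro x
    rw [pow_succ, mul_two, ← add_assoc, ih, ih]

theorem isTwoPowInvariant_setOf_two_pow_dvd (k : ℕ) :
    IsTwoPowInvariant k {x : ℤ_[2] | (2 : ℤ_[2]) ^ k ∣ x} :=
  fun _ => dvd_add_left dvd_rfl

theorem add_natCast_mem_zeroDigitSet_iff {K n : ℕ} {x : ℤ_[2]}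
    (h : ∀ i < n, ¬ (2 : ℤ_[2]) ^ K ∣ x + (i : ℤ_[2])) {i : ℕ} (hi : i < n) :
    x + (i : ℤ_[2]) ∈ zeroDigitSet K ↔ x ∈ zeroDigitSet K := by
  induction i with
  | zero => simp
  | succ i ih =>
    have := h _ hi
    push_cast at this ⊢
    rw [← add_assoc] at this ⊢
    rw [add_one_mem_zeroDigitSet_iff K _ this, ih (by omega)]

section Odometer

variable [MeasurableSpace ℤ_[2]] [BorelSpace ℤ_[2]]

theorem measurable_odometerItinerary {A : Set ℤ_[2]} (hA : MeasurableSet A) :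
    Measurable (odometerItinerary A) := by
  refine measurable_pi_lambda _ fun n => ?_
  refine measurable_to_bool ?_
  have : (fun x => odometerItinerary A x n) ⁻¹' {true} = (fun x => x + (n : ℤ_[2])) ⁻¹' A := by
    ext x
    simp [odometerItinerary]
  rw [this]
  exact hA.preimage (measurable_add_const _)

theorem measurableSet_rejectionSet (D : ∀ n : ℕ, (Fin n → Bool) → (Fin n → Bool) → Bool) (n : ℕ)
    {A B : Set ℤ_[2]} (hA : MeasurableSet A) (hB : MeasurableSet B) :
    MeasurableSet (rejectionSet D n A B) :=
  (measurableSet_setOf_discrimination D n).preimage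
    ((measurable_odometerItinerary hA).prodMap (measurable_odometerItinerary hB))

theorem measurableSet_setOf_two_pow_dvd (k : ℕ) :
    MeasurableSet {x : ℤ_[2] | (2 : ℤ_[2]) ^ k ∣ x} := by
  rw [setOf_two_pow_dvd_eq_closedBall]
  exact Metric.isClosed_closedBall.measurableSet

theorem measurableSet_zeroDigitSet (K : ℕ) : MeasurableSet (zeroDigitSet K) := by
  have : zeroDigitSet K = ⋃ j ∈ Finset.range (2 ^ K),
      (fun x => x - ((j : ℕ) : ℤ_[2])) ⁻¹' {x | (2 : ℤ_[2]) ^ (K + 1) ∣ x} := by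
    ext x
    simp [zeroDigitSet]
  rw [this]
  exact Finset.measurableSet_biUnion _ fun j _ =>
    (measurableSet_setOf_two_pow_dvd _).preimage (measurable_sub_const _)

variable {μ : Measure ℤ_[2]}

theorem measureReal_setOf_exists_lt_add_mem_le [μ.IsAddHaarMeasure] {E : Set ℤ_[2]}
    (hE : MeasurableSet E) (n : ℕ) :
    μ.real {x | ∃ i < n, x + (i : ℤ_[2]) ∈ E} ≤ n * μ.real E := by
  have h1 : {x | ∃ i < n, x + (i : ℤ_[2]) ∈ E} =
      ⋃ i ∈ Finset.range n, (fun x => x + (i : ℤ_[2])) ⁻¹' E := by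
    ext x
    simp
  rw [h1]
  refine (measureReal_biUnion_finset_le _ _).trans ?_
  have h2 (i : ℕ) : μ.real ((fun x => x + (i : ℤ_[2])) ⁻¹' E) = μ.real E :=
    (measurePreserving_add_right μ (i : ℤ_[2])).measureReal_preimage hE.nullMeasurableSet
  simp [h2]

theorem measureReal_map_odometerItinerary {A : Set ℤ_[2]} (hA : MeasurableSet A) :
    (μ.map (odometerItinerary A)).real {s | s 0 = true} = μ.real A := by
  have h : MeasurableSet {s : BinSeq | s 0 = true} :=
    measurableSet_eq_fun (measurable_pi_apply 0) measurable_const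
  rw [map_measureReal_apply (measurable_odometerItinerary hA) h]
  congr 1
  ext x
  simp [odometerItinerary]

variable [IsProbabilityMeasure μ]

theorem expD_map_odometerItinerary (D : ∀ n : ℕ, (Fin n → Bool) → (Fin n → Bool) → Bool) (n : ℕ)
    {A B : Set ℤ_[2]} (hA : MeasurableSet A) (hB : MeasurableSet B) :
    expD D (μ.map (odometerItinerary A)) (μ.map (odometerItinerary B)) n =
      (μ.prod μ).real (rejectionSet D n A B) := by
  have hf := measurable_odometerItinerary hA
  have hg := measurable_odometerItinerary hB
  have hR := measurableSet_setOf_discrimination D n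
  have h1 : (fun z : BinSeq × BinSeq =>
      if D n (fun i => z.1 ↑i) (fun i => z.2 ↑i) then (1 : ℝ) else 0) =
      Set.indicator {z | D n (fun i => z.1 ↑i) (fun i => z.2 ↑i) = true} 1 := by
    ext z
    simp [Set.indicator]
  rw [expD, h1, integral_indicator_one hR, Measure.map_prod_map _ _ hf hg,
    map_measureReal_apply (hf.prodMap hg) hR]
  rfl

variable [μ.IsAddHaarMeasure]

theorem ergodic_odometer : Ergodic (fun x : ℤ_[2] => 1 + x) μ := by
  refine ergodic_add_left_of_denseRange_nsmul (g := (1 : ℤ_[2])) ?_ μ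
  simpa using PadicInt.denseRange_natCast (p := 2)

theorem ergodic_shift_map_odometerItinerary {A : Set ℤ_[2]} (hA : MeasurableSet A) :
    Ergodic shift (μ.map (odometerItinerary A)) := by
  refine ((measurable_odometerItinerary hA).measurePreserving μ).ergodic_of_ergodic_semiconj
    ergodic_odometer measurable_shift fun x => ?_
  funext n
  simp only [odometerItinerary, shift]
  congr 2
  push_cast
  ring

/-- The rejection probability depends continuously on the coding set. -/
theorem measureReal_rejectionSet_le (D : ∀ n : ℕ, (Fin n → Bool) → (Fin n → Bool) → Bool) (n : ℕ)
    {A B E : Set ℤ_[2]} (hE : MeasurableSet E) (hAB : ∀ x ∉ E, x ∈ A ↔ x ∈ B) :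
    (μ.prod μ).real (rejectionSet D n A A) ≤
      (μ.prod μ).real (rejectionSet D n B B) + 2 * (n * μ.real E) := by
  have h := measureReal_prod_le_add_of_subset (μ := μ) (S := rejectionSet D n A A)
    (T := rejectionSet D n B B) (E := {x | ∃ i < n, x + (i : ℤ_[2]) ∈ E}) ?_
  · linarith [measureReal_setOf_exists_lt_add_mem_le (μ := μ) hE n]
  · intro z hz h1 h2
    simp only [Set.mem_ofPred_eq, not_exists, not_and] at h1 h2
    simp only [rejectionSet, Set.mem_ofPred_eq] at hz ⊢
    rwa [← odometerItinerary_congr fun i hi => hAB _ (h1 i hi),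
      ← odometerItinerary_congr fun i hi => hAB _ (h2 i hi)]

theorem measureReal_setOf_two_pow_dvd (k : ℕ) :
    μ.real {x : ℤ_[2] | (2 : ℤ_[2]) ^ k ∣ x} = (1 / 2) ^ k := by
  induction k with
  | zero => simp
  | succ k ih =>
    have hsub : {x : ℤ_[2] | (2 : ℤ_[2]) ^ k ∣ x} ∩ {x : ℤ_[2] | (2 : ℤ_[2]) ^ (k + 1) ∣ x} =
        {x : ℤ_[2] | (2 : ℤ_[2]) ^ (k + 1) ∣ x} :=
      Set.inter_eq_right.2 fun x hx => (pow_dvd_pow 2 k.le_succ).trans hx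
    have h := measureReal_eq_two_mul_of_preimage_inter
      (measurePreserving_add_right μ ((2 : ℤ_[2]) ^ k))
      (measurableSet_setOf_two_pow_dvd k) (measurableSet_setOf_two_pow_dvd (k + 1)) ?_
    · rw [hsub, ih] at h
      rw [pow_succ (1 / 2 : ℝ)]
      linarith
    · rw [hsub]
      ext x
      simp only [Set.mem_preimage, Set.mem_ofPred_eq, Set.mem_sdiff]
      have h2 : (2 : ℤ_[2]) ^ k ≠ 0 := pow_ne_zero _ two_ne_zero
      constructor
      · intro hx
        have hk : (2 : ℤ_[2]) ^ k ∣ x :=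
          (dvd_add_left dvd_rfl).1 ((pow_dvd_pow 2 k.le_succ).trans hx)
        obtain ⟨y, rfl⟩ := hk
        refine ⟨dvd_mul_right _ _, ?_⟩
        rw [pow_succ, show (2 : ℤ_[2]) ^ k * y + 2 ^ k = 2 ^ k * (y + 1) by ring,
          mul_dvd_mul_iff_left h2] at hx
        rw [pow_succ, mul_dvd_mul_iff_left h2]
        exact (PadicInt.not_two_dvd_iff_two_dvd_add_one y).2 hx
      · rintro ⟨⟨y, rfl⟩, hx⟩
        rw [pow_succ, mul_dvd_mul_iff_left h2] at hx
        rw [pow_succ, show (2 : ℤ_[2]) ^ k * y + 2 ^ k = 2 ^ k * (y + 1) by ring,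
          mul_dvd_mul_iff_left h2]
        exact (PadicInt.not_two_dvd_iff_two_dvd_add_one y).1 hx

/-- Restricting to opposite values of an independent binary digit in both coordinates divides the
rejection probability by four. -/
theorem measureReal_rejectionSet_eq_four_mul
    (D : ∀ n : ℕ, (Fin n → Bool) → (Fin n → Bool) → Bool) (n : ℕ) {K : ℕ} {A B : Set ℤ_[2]}
    (hA : MeasurableSet A) (hB : MeasurableSet B)
    (hA' : IsTwoPowInvariant K A) (hB' : IsTwoPowInvariant K B) :
    (μ.prod μ).real (rejectionSet D n A B) =
      4 * (μ.prod μ).real (rejectionSet D n A B ∩ Prod.fst ⁻¹' zeroDigitSet K ∩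
        Prod.snd ⁻¹' (zeroDigitSet K)ᶜ) := by
  have hC := measurableSet_zeroDigitSet K
  have hS := measurableSet_rejectionSet D n hA hB
  have hC1 : MeasurableSet (Prod.fst ⁻¹' zeroDigitSet K : Set (ℤ_[2] × ℤ_[2])) :=
    hC.preimage measurable_fst
  have hC2 : MeasurableSet (Prod.snd ⁻¹' (zeroDigitSet K)ᶜ : Set (ℤ_[2] × ℤ_[2])) :=
    hC.compl.preimage measurable_snd
  have itA (x : ℤ_[2]) : odometerItinerary A (x + 2 ^ K) = odometerItinerary A x := by
    funext i
    simp only [odometerItinerary]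
    rw [add_right_comm, hA']
  have itB (x : ℤ_[2]) : odometerItinerary B (x + 2 ^ K) = odometerItinerary B x := by
    funext i
    simp only [odometerItinerary]
    rw [add_right_comm, hB']
  have hτ := measurePreserving_add_right μ ((2 : ℤ_[2]) ^ K)
  have h1 := measureReal_eq_two_mul_of_preimage_inter (hτ.prod (MeasurePreserving.id μ)) hS hC1 (by
    ext z
    simp [rejectionSet, itA, add_two_pow_mem_zeroDigitSet_iff])
  have h2 := measureReal_eq_two_mul_of_preimage_inter ((MeasurePreserving.id μ).prod hτ)
    (hS.inter hC1) hC2 (by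
    ext z
    simp [rejectionSet, itB, add_two_pow_mem_zeroDigitSet_iff])
  linarith

/-- If `D` separates distinct processes, every periodic coding set has a small periodic
perturbation whose process is often declared different from itself. -/
theorem exists_perturbation_rejection
    {D : ∀ n : ℕ, (Fin n → Bool) → (Fin n → Bool) → Bool}
    (H : ∀ A B : Set ℤ_[2], MeasurableSet A → MeasurableSet B → μ.real A ≠ μ.real B →
      Filter.Tendsto (fun n => (μ.prod μ).real (rejectionSet D n A B)) Filter.atTop (nhds 1))
    {A : Set ℤ_[2]} (hA : MeasurableSet A) {k : ℕ} (hk : IsTwoPowInvariant k A)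
    {ε : ℝ} (hε : 0 < ε) (N : ℕ) :
    ∃ n > N, ∃ (B : Set ℤ_[2]) (l : ℕ), MeasurableSet B ∧ IsTwoPowInvariant l B ∧
      μ.real (symmDiff A B) ≤ ε ∧ 1 / 8 ≤ (μ.prod μ).real (rejectionSet D n B B) := by
  obtain ⟨m, hm⟩ := exists_pow_lt_of_lt_one hε (by norm_num : (1 / 2 : ℝ) < 1)
  set l := max k m with hl
  set U := {x : ℤ_[2] | (2 : ℤ_[2]) ^ l ∣ x} with hU
  have hUm : MeasurableSet U := measurableSet_setOf_two_pow_dvd l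
  have hUμ : μ.real U = (1 / 2) ^ l := measureReal_setOf_two_pow_dvd l
  have hUε : μ.real U ≤ ε := by
    rw [hUμ]
    exact (pow_le_pow_of_le_one (by norm_num) (by norm_num) (le_max_right k m)).trans hm.le
  have hUpos : 0 < μ.real U := by
    rw [hUμ]
    positivity
  have hUl : IsTwoPowInvariant l U := isTwoPowInvariant_setOf_two_pow_dvd l
  have hAl : IsTwoPowInvariant l A := hk.mono (le_max_left k m)
  obtain ⟨A', hA', hA'l, hAA', hne⟩ : ∃ A' : Set ℤ_[2], MeasurableSet A' ∧
      IsTwoPowInvariant l A' ∧ (∀ x ∉ U, x ∈ A ↔ x ∈ A') ∧ μ.real A ≠ μ.real A' := by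
    by_cases h : μ.real A = μ.real (A ∪ U)
    · refine ⟨A \ U, hA.diff hUm, fun x => ?_, fun x hx => by simp [hx], ?_⟩
      · simp only [Set.mem_sdiff, hUl x, hAl x]
      · intro h'
        have h1 := measureReal_union (μ := μ) (Set.disjoint_sdiff_left (s := U) (t := A)) hUm
        rw [Set.sdiff_union_self] at h1
        linarith
    · refine ⟨A ∪ U, hA.union hUm, fun x => ?_, fun x hx => by simp [hx], h⟩
      simp only [Set.mem_union, hUl x, hAl x]
  obtain ⟨n, hnN, hn⟩ : ∃ n > N, 7 / 8 < (μ.prod μ).real (rejectionSet D n A A') :=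
    (((Filter.eventually_gt_atTop N).and
      ((H A A' hA hA' hne).eventually (lt_mem_nhds (by norm_num)))).exists)
  obtain ⟨q, hq⟩ := exists_pow_lt_of_lt_one (show (0 : ℝ) < 1 / (32 * (n + 1)) by positivity)
    (by norm_num : (1 / 2 : ℝ) < 1)
  set K := max l q with hK
  set V := {x : ℤ_[2] | (2 : ℤ_[2]) ^ K ∣ x} with hV
  have hVm : MeasurableSet V := measurableSet_setOf_two_pow_dvd K
  have hVμ : n * μ.real V ≤ 1 / 32 := by
    have h1 : μ.real V ≤ 1 / (32 * (n + 1)) := by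
      rw [hV, measureReal_setOf_two_pow_dvd]
      exact (pow_le_pow_of_le_one (by norm_num) (by norm_num) (le_max_right l q)).trans hq.le
    rw [le_div_iff₀ (by positivity)] at h1
    nlinarith [measureReal_nonneg (μ := μ) (s := V)]
  set C := zeroDigitSet K with hC
  have hCm : MeasurableSet C := measurableSet_zeroDigitSet K
  have hAK := hAl.mono (le_max_left l q)
  have hA'K := hA'l.mono (le_max_left l q)
  refine ⟨n, hnN, A ∩ C ∪ A' \ C, K + 1, (hA.inter hCm).union (hA'.diff hCm), fun x => ?_, ?_, ?_⟩
  · have hCK : x + 2 ^ (K + 1) ∈ C ↔ x ∈ C := by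
      rw [pow_succ, mul_two, ← add_assoc, add_two_pow_mem_zeroDigitSet_iff,
        add_two_pow_mem_zeroDigitSet_iff, not_not]
    simp only [Set.mem_union, Set.mem_inter_iff, Set.mem_sdiff, hCK, hAK.mono K.le_succ x,
      hA'K.mono K.le_succ x]
  · refine (measureReal_mono fun x hx => ?_).trans hUε
    by_contra hxU
    have := hAA' x hxU
    simp only [Set.mem_symmDiff, Set.mem_union, Set.mem_inter_iff, Set.mem_sdiff] at hx
    tauto
  · have h4 := measureReal_rejectionSet_eq_four_mul (μ := μ) D n hA hA' hAK hA'K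
    have hE := measureReal_setOf_exists_lt_add_mem_le (μ := μ) hVm n
    have h := measureReal_prod_le_add_of_subset (μ := μ)
      (S := rejectionSet D n A A' ∩ Prod.fst ⁻¹' C ∩ Prod.snd ⁻¹' Cᶜ)
      (T := rejectionSet D n (A ∩ C ∪ A' \ C) (A ∩ C ∪ A' \ C))
      (E := {x | ∃ i < n, x + (i : ℤ_[2]) ∈ V}) ?_
    · linarith
    · rintro ⟨x, y⟩ ⟨⟨hz, hx⟩, hy⟩ hxE hyE
      simp only [Set.mem_ofPred_eq, not_exists, not_and] at hxE hyE
      simp only [Set.mem_preimage, Set.mem_compl_iff] at hx hy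
      simp only [rejectionSet, Set.mem_ofPred_eq] at hz ⊢
      rwa [odometerItinerary_congr (A := A ∩ C ∪ A' \ C) (B := A) (y := x) fun i hi => ?_,
        odometerItinerary_congr (A := A ∩ C ∪ A' \ C) (B := A') (y := y) fun i hi => ?_]
      · have := mt (add_natCast_mem_zeroDigitSet_iff hyE hi).1 hy
        simp [hC, this]
      · have := (add_natCast_mem_zeroDigitSet_iff hxE hi).2 hx
        simp [hC, this]

/-- No test accepts each process coded from the odometer against itself and rejects every pair of
such processes with different densities. -/
theorem exists_not_tendsto_rejection
    {D : ∀ n : ℕ, (Fin n → Bool) → (Fin n → Bool) → Bool}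
    (H : ∀ A B : Set ℤ_[2], MeasurableSet A → MeasurableSet B → μ.real A ≠ μ.real B →
      Filter.Tendsto (fun n => (μ.prod μ).real (rejectionSet D n A B)) Filter.atTop (nhds 1)) :
    ∃ A : Set ℤ_[2], MeasurableSet A ∧
      ¬ Filter.Tendsto (fun n => (μ.prod μ).real (rejectionSet D n A A)) Filter.atTop (nhds 0) := by
  let P : ℕ × Set ℤ_[2] × ℝ → Prop := fun s =>
    MeasurableSet s.2.1 ∧ (∃ k, IsTwoPowInvariant k s.2.1) ∧ 0 < s.2.2 ∧ s.1 * s.2.2 ≤ 1 / 64 ∧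
      1 / 8 ≤ (μ.prod μ).real (rejectionSet D s.1 s.2.1 s.2.1)
  have step : ∀ {A : Set ℤ_[2]}, MeasurableSet A → (∃ k, IsTwoPowInvariant k A) → ∀ {ε : ℝ},
      0 < ε → ∀ N : ℕ, ∃ s, P s ∧ N < s.1 ∧ μ.real (symmDiff A s.2.1) ≤ ε ∧ s.2.2 ≤ ε / 2 := by
    rintro A hA ⟨k, hk⟩ ε hε N
    obtain ⟨n, hn, B, l, hB, hl, hAB, hr⟩ := exists_perturbation_rejection H hA hk hε N
    refine ⟨(n, B, min (ε / 2) (1 / (64 * (n + 1)))), ⟨hB, ⟨l, hl⟩, by positivity, ?_, hr⟩, hn, hAB,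
      min_le_left _ _⟩
    have h1 : min (ε / 2) (1 / (64 * ((n : ℝ) + 1))) ≤ 1 / (64 * (n + 1)) := min_le_right _ _
    refine (mul_le_mul_of_nonneg_left h1 n.cast_nonneg).trans ?_
    rw [mul_one_div, div_le_div_iff₀ (by positivity) (by norm_num)]
    linarith
  obtain ⟨s₀, hs₀, -⟩ := step MeasurableSet.empty ⟨0, fun x => by simp⟩ one_pos 0
  have next (s : {s // P s}) : ∃ t : {s // P s}, s.1.1 < t.1.1 ∧
      μ.real (symmDiff s.1.2.1 t.1.2.1) ≤ s.1.2.2 ∧ t.1.2.2 ≤ s.1.2.2 / 2 := by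
    obtain ⟨t, ht, h⟩ := step s.2.1 s.2.2.1 s.2.2.2.1 s.1.1
    exact ⟨⟨t, ht⟩, h⟩
  choose f hf using next
  let u : ℕ → {s // P s} := fun m => f^[m] ⟨s₀, hs₀⟩
  have hu (m : ℕ) : u (m + 1) = f (u m) := Function.iterate_succ_apply' f m _
  let a : ℕ → ℕ := fun m => (u m).1.1
  let A : ℕ → Set ℤ_[2] := fun m => (u m).1.2.1
  let ε : ℕ → ℝ := fun m => (u m).1.2.2
  have hA (m : ℕ) : MeasurableSet (A m) := (u m).2.1
  have hε (m : ℕ) : 0 < ε m := (u m).2.2.2.1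
  have haε (m : ℕ) : a m * ε m ≤ 1 / 64 := (u m).2.2.2.2.1
  have hrej (m : ℕ) : 1 / 8 ≤ (μ.prod μ).real (rejectionSet D (a m) (A m) (A m)) :=
    (u m).2.2.2.2.2
  have ha : StrictMono a := strictMono_nat_of_lt_succ fun m => by
    simpa only [a, hu] using (hf (u m)).1
  have hAs (m : ℕ) : μ.real (symmDiff (A m) (A (m + 1))) ≤ ε m := by
    simpa only [A, ε, hu] using (hf (u m)).2.1
  have hεs (m : ℕ) : ε (m + 1) ≤ ε m / 2 := by
    simpa only [ε, hu] using (hf (u m)).2.2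
  have hεg (m i : ℕ) : ε (m + i) ≤ ε m * (1 / 2) ^ i := by
    induction i with
    | zero => simp
    | succ i ih =>
      have := hεs (m + i)
      rw [← add_assoc, pow_succ]
      linarith
  let E : ℕ → Set ℤ_[2] := fun m => ⋃ i, symmDiff (A (m + i)) (A (m + i + 1))
  have hEm (m : ℕ) : MeasurableSet (E m) :=
    MeasurableSet.iUnion fun i => (hA _).symmDiff (hA _)
  have hEμ (m : ℕ) : μ.real (E m) ≤ 2 * ε m := by
    have hsum : HasSum (fun i : ℕ => ε m * (1 / 2) ^ i) (ε m * 2) :=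
      hasSum_geometric_two.mul_left _
    refine ENNReal.toReal_le_of_le_ofReal (by linarith [hε m]) ?_
    refine (measure_iUnion_le _).trans ?_
    rw [mul_comm 2, ← hsum.tsum_eq, ENNReal.ofReal_tsum_of_nonneg
      (fun i => mul_nonneg (hε m).le (by positivity)) hsum.summable]
    refine ENNReal.tsum_le_tsum fun i => ?_
    rw [← ofReal_measureReal]
    exact ENNReal.ofReal_le_ofReal ((hAs _).trans (hεg m i))
  let L : Set ℤ_[2] := ⋃ N, ⋂ j, A (N + j)
  have hL : MeasurableSet L := MeasurableSet.iUnion fun N => MeasurableSet.iInter fun j => hA _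
  have hAL (m : ℕ) : ∀ x ∉ E m, x ∈ A m ↔ x ∈ L := by
    intro x hx
    have hstep (i : ℕ) : x ∈ A (m + i) ↔ x ∈ A m := by
      induction i with
      | zero => rfl
      | succ i ih =>
        have : x ∉ symmDiff (A (m + i)) (A (m + i + 1)) := fun h => hx (Set.mem_iUnion.2 ⟨i, h⟩)
        rw [Set.mem_symmDiff] at this
        rw [← ih, ← add_assoc]
        tauto
    simp only [L, Set.mem_iUnion, Set.mem_iInter]
    constructor
    · exact fun h => ⟨m, fun j => (hstep j).2 h⟩
    · rintro ⟨N, hN⟩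
      rw [← hstep N, add_comm]
      exact hN m
  refine ⟨L, hL, fun hlim => ?_⟩
  have hlim' := (hlim.comp ha.tendsto_atTop).eventually (gt_mem_nhds (show (0 : ℝ) < 1 / 16 by
    norm_num))
  obtain ⟨m, hm⟩ := hlim'.exists
  have h1 := measureReal_rejectionSet_le (μ := μ) D (a m) (hEm m) (hAL m)
  have h2 : a m * μ.real (E m) ≤ 1 / 32 := by
    have := mul_le_mul_of_nonneg_left (hEμ m) (a m).cast_nonneg
    linarith [haε m]
  have h3 := hrej m
  simp only [Function.comp_apply] at hm
  linarith

end Odometer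


/-- There is no asymptotically correct discrimination procedure for the class of all
stationary ergodic binary processes: for every family `D = (D_n)` of (automatically
measurable, since the domains are finite) maps `D_n : {0,1}^n × {0,1}^n → {0,1}`, it
is not the case that for all stationary ergodic binary processes `ρx, ρy`, the
expectation `E[D_n]` converges to `0` if `ρx = ρy` and to `1` otherwise. -/
theorem no_asymptotically_correct_discrimination_for_stationary_ergodic
    (D : ∀ n : ℕ, (Fin n → Bool) → (Fin n → Bool) → Bool) :
    ¬ (∀ ρx ρy : Measure BinSeq,
        IsProbabilityMeasure ρx → IsProbabilityMeasure ρy →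
        Ergodic shift ρx → Ergodic shift ρy →
        Filter.Tendsto (fun n => expD D ρx ρy n) Filter.atTop
          (nhds (if ρx = ρy then (0 : ℝ) else 1))) := by
  intro h
  borelize ℤ_[2]
  let μ : Measure ℤ_[2] := Measure.addHaarMeasure ⊤
  have : IsProbabilityMeasure μ := ⟨by
    simpa using Measure.addHaarMeasure_self (K₀ := (⊤ : TopologicalSpace.PositiveCompacts ℤ_[2]))⟩
  have key (A B : Set ℤ_[2]) (hA : MeasurableSet A) (hB : MeasurableSet B) :
      Filter.Tendsto (fun n => (μ.prod μ).real (rejectionSet D n A B)) Filter.atTop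
        (nhds (if μ.map (odometerItinerary A) = μ.map (odometerItinerary B) then 0 else 1)) := by
    simpa only [expD_map_odometerItinerary D _ hA hB] using
      h (μ.map (odometerItinerary A)) (μ.map (odometerItinerary B))
      (Measure.isProbabilityMeasure_map (measurable_odometerItinerary hA).aemeasurable)
      (Measure.isProbabilityMeasure_map (measurable_odometerItinerary hB).aemeasurable)
      (ergodic_shift_map_odometerItinerary hA) (ergodic_shift_map_odometerItinerary hB)
  obtain ⟨A, hA, hA'⟩ := exists_not_tendsto_rejection (μ := μ) (D := D) fun A B hA hB hAB => by
    have hlaw : μ.map (odometerItinerary A) ≠ μ.map (odometerItinerary B) := fun h' => hAB (by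
      rw [← measureReal_map_odometerItinerary hA, h', measureReal_map_odometerItinerary hB])
    simpa only [if_neg hlaw] using key A B hA hB
  exact hA' (by simpa using key A A hA hA)
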